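/- Let k be an odd integer and x ∈ ℝ, and set w = (x−i)²/(x²+1) ∈ ℂ (so |w| = 1 and w ≠ 1). Then (1/π)·PV∫ u_k'(y)/(x−y) dy = −2i/(π(k−2)) + k·(x+i)^k/(x²+1)^{k/2+1} − (8i/(π(4−k²)))·∑_{n=0}^∞ [(1)_n·(k/2−1)_n/((k/2+2)_n · n!)]·w^n, i.e. the principal value equals −2i/(π(k−2)) + k(x+i)^k/(x²+1)^{k/2+1} − (8i/(π(4−k²)))·₂F₁(1, k/2−1; k/2+2; w). -/

import Mathlib

open Filter MeasureTheory

/-- `u_k(y) = (y+i)^k/(y²+1)^{k/2}`, with `(y+i)^k` a `zpow` in `ℂ` and `(y²+1)^{k/2}` a real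
power. -/
noncomputable def uFun (k : ℤ) (y : ℝ) : ℂ :=
  ((y : ℂ) + Complex.I) ^ k / ((((y ^ 2 + 1 : ℝ) ^ ((k : ℝ) / 2) : ℝ)) : ℂ)

open Topology Complex

lemma sq_add_one_rpow_half (k : ℤ) (y : ℝ) :
    (y ^ 2 + 1 : ℝ) ^ ((k : ℝ) / 2) = √(1 + y ^ 2) ^ k := by
  have h : (0 : ℝ) ≤ 1 + y ^ 2 := by positivity
  rw [Real.sqrt_eq_rpow, ← Real.rpow_intCast, ← Real.rpow_mul h, add_comm]
  ring_nf

lemma uFun_one (y : ℝ) : uFun 1 y = (y + I) / (√(1 + y ^ 2) : ℂ) := by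
  rw [uFun, sq_add_one_rpow_half]
  simp

lemma uFun_eq_zpow (k : ℤ) (y : ℝ) : uFun k y = uFun 1 y ^ k := by
  rw [uFun_one, uFun, sq_add_one_rpow_half, div_zpow, ofReal_zpow]

lemma ofReal_sqrt_one_add_sq_ne_zero (y : ℝ) : (√(1 + y ^ 2) : ℂ) ≠ 0 := by
  rw [ofReal_ne_zero]
  positivity

lemma ofReal_sqrt_one_add_sq_sq (y : ℝ) : (√(1 + y ^ 2) : ℂ) ^ 2 = 1 + (y : ℂ) ^ 2 := by
  rw [← ofReal_pow, Real.sq_sqrt (by positivity)]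
  push_cast
  rfl

lemma ofReal_sub_I_ne_zero (y : ℝ) : (y : ℂ) - I ≠ 0 := fun h => by
  simpa using congrArg Complex.im h

lemma ofReal_add_I_ne_zero (y : ℝ) : (y : ℂ) + I ≠ 0 := fun h => by
  simpa using congrArg Complex.im h

lemma add_I_mul_sub_I (y : ℂ) : (y + I) * (y - I) = 1 + y ^ 2 := by
  linear_combination -I_sq

lemma one_add_ofReal_sq_ne_zero (y : ℝ) : (1 : ℂ) + (y : ℂ) ^ 2 ≠ 0 := by
  rw [← add_I_mul_sub_I]
  exact mul_ne_zero (ofReal_add_I_ne_zero y) (ofReal_sub_I_ne_zero y)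

lemma uFun_ne_zero (k : ℤ) (y : ℝ) : uFun k y ≠ 0 := by
  rw [uFun_eq_zpow, uFun_one]
  exact zpow_ne_zero _ (div_ne_zero (ofReal_add_I_ne_zero y) (ofReal_sqrt_one_add_sq_ne_zero y))

lemma norm_uFun (k : ℤ) (y : ℝ) : ‖uFun k y‖ = 1 := by
  have h : ‖(y : ℂ) + I‖ = √(1 + y ^ 2) := by
    have := norm_add_mul_I y 1
    simpa [add_comm] using this
  rw [uFun_eq_zpow, uFun_one, norm_zpow, norm_div, h, norm_real, Real.norm_of_nonneg (by positivity),
    div_self (by positivity), one_zpow]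

/-- With `y = cot θ`, this is `exp (2 i θ) = (y + i) / (y - i)`. -/
lemma uFun_two (y : ℝ) : uFun 1 y ^ 2 = (y + I) / (y - I) := by
  rw [uFun_one, div_pow, ofReal_sqrt_one_add_sq_sq, ← add_I_mul_sub_I]
  field_simp [ofReal_add_I_ne_zero, ofReal_sub_I_ne_zero]

lemma uFun_add_two (k : ℤ) (y : ℝ) : uFun (k + 2) y = (y + I) / (y - I) * uFun k y := by
  have h := uFun_ne_zero 1 y
  rw [uFun_eq_zpow (k + 2), zpow_add₀ h, ← uFun_eq_zpow, ← uFun_two, mul_comm]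
  norm_cast

lemma hasDerivAt_sqrt_one_add_sq (y : ℝ) :
    HasDerivAt (fun t : ℝ => √(1 + t ^ 2)) (y / √(1 + y ^ 2)) y := by
  have h := ((hasDerivAt_pow 2 y).const_add 1).sqrt (by positivity)
  convert h using 1
  field_simp
  norm_num
  ring

lemma hasDerivAt_uFun (k : ℤ) (y : ℝ) :
    HasDerivAt (uFun k) (-I * k * uFun k y / (1 + (y : ℂ) ^ 2)) y := by
  have hs := ofReal_sqrt_one_add_sq_ne_zero y
  have hs2 := ofReal_sqrt_one_add_sq_sq y
  have h0 := one_add_ofReal_sq_ne_zero y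
  have h1 : HasDerivAt (uFun 1) (-I * uFun 1 y / (1 + (y : ℂ) ^ 2)) y := by
    have hn : HasDerivAt (fun t : ℝ => (t : ℂ) + I) 1 y := ofRealCLM.hasDerivAt.add_const I
    have := hn.div (hasDerivAt_sqrt_one_add_sq y).ofReal_comp hs
    refine (this.congr_of_eventuallyEq (.of_forall uFun_one)).congr_deriv ?_
    rw [uFun_one, ← hs2]
    push_cast
    field_simp
    rw [hs2]
    linear_combination I_sq
  have h2 := (hasDerivAt_zpow k (uFun 1 y) (Or.inl (uFun_ne_zero 1 y))).comp y h1
  have h3 : (fun z : ℂ => z ^ k) ∘ uFun 1 = uFun k := funext fun t => (uFun_eq_zpow k t).symm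
  rw [h3] at h2
  refine h2.congr_deriv ?_
  have := uFun_ne_zero 1 y
  rw [uFun_eq_zpow k, zpow_sub_one₀ this]
  field_simp

lemma tendsto_self_div_sqrt_atTop :
    Tendsto (fun y : ℝ => y / √(1 + y ^ 2)) atTop (𝓝 1) := by
  simp_rw [← Real.sin_arctan]
  rw [← Real.sin_pi_div_two]
  exact (Real.continuous_sin.tendsto _).comp
    (tendsto_nhds_of_tendsto_nhdsWithin Real.tendsto_arctan_atTop)

lemma tendsto_self_div_sqrt_atBot :
    Tendsto (fun y : ℝ => y / √(1 + y ^ 2)) atBot (𝓝 (-1)) := by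
  simp_rw [← Real.sin_arctan]
  rw [← Real.sin_pi_div_two, ← Real.sin_neg]
  exact (Real.continuous_sin.tendsto _).comp
    (tendsto_nhds_of_tendsto_nhdsWithin Real.tendsto_arctan_atBot)

lemma tendsto_one_div_sqrt_atTop :
    Tendsto (fun y : ℝ => 1 / √(1 + y ^ 2)) atTop (𝓝 0) := by
  simp_rw [← Real.cos_arctan]
  rw [← Real.cos_pi_div_two]
  exact (Real.continuous_cos.tendsto _).comp
    (tendsto_nhds_of_tendsto_nhdsWithin Real.tendsto_arctan_atTop)

lemma tendsto_one_div_sqrt_atBot :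
    Tendsto (fun y : ℝ => 1 / √(1 + y ^ 2)) atBot (𝓝 0) := by
  simp_rw [← Real.cos_arctan]
  rw [← Real.cos_pi_div_two, ← Real.cos_neg]
  exact (Real.continuous_cos.tendsto _).comp
    (tendsto_nhds_of_tendsto_nhdsWithin Real.tendsto_arctan_atBot)

lemma tendsto_uFun {l : Filter ℝ} {c : ℝ} (hc : c ≠ 0)
    (h1 : Tendsto (fun y : ℝ => y / √(1 + y ^ 2)) l (𝓝 c))
    (h2 : Tendsto (fun y : ℝ => 1 / √(1 + y ^ 2)) l (𝓝 0)) (k : ℤ) :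
    Tendsto (uFun k) l (𝓝 ((c : ℂ) ^ k)) := by
  have h : Tendsto (uFun 1) l (𝓝 c) := by
    have h3 := h1.ofReal.add (h2.ofReal.mul_const I)
    simp only [ofReal_zero, zero_mul, add_zero] at h3
    refine h3.congr fun y => ?_
    rw [uFun_one]
    push_cast
    ring
  rw [funext (uFun_eq_zpow k)]
  exact h.zpow₀ k (Or.inl (by exact_mod_cast hc))

lemma tendsto_uFun_atTop (k : ℤ) : Tendsto (uFun k) atTop (𝓝 1) := by
  simpa using tendsto_uFun one_ne_zero tendsto_self_div_sqrt_atTop tendsto_one_div_sqrt_atTop k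

lemma tendsto_uFun_atBot {k : ℤ} (hk : Odd k) : Tendsto (uFun k) atBot (𝓝 (-1)) := by
  simpa [hk.neg_one_zpow] using
    tendsto_uFun (by norm_num) tendsto_self_div_sqrt_atBot tendsto_one_div_sqrt_atBot k

lemma continuous_uFun (k : ℤ) : Continuous (uFun k) :=
  continuous_iff_continuousAt.2 fun y => (hasDerivAt_uFun k y).continuousAt

/-- The Cauchy principal value `PV∫ f` at the singularity `x` exists and equals `L`. -/
def HasPrincipalValue (f : ℝ → ℂ) (x : ℝ) (L : ℂ) : Prop :=
  Tendsto (fun ε : ℝ => ∫ y in {y : ℝ | ε ≤ |x - y|}, f y) (𝓝[>] 0) (𝓝 L)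

lemma setOf_le_abs_sub_eq_union (ε x : ℝ) :
    {y : ℝ | ε ≤ |x - y|} = Set.Iic (x - ε) ∪ Set.Ici (x + ε) := by
  ext y
  simp only [Set.mem_ofPred_eq, le_abs, Set.mem_union, Set.mem_Iic, Set.mem_Ici]
  constructor <;> (rintro (h | h) <;> [left; right] <;> linarith)

/-- The fundamental theorem of calculus for principal values. -/
lemma hasPrincipalValue_of_hasDerivAt {f F : ℝ → ℂ} {x : ℝ} {a b d : ℂ}
    (hF : ∀ y ≠ x, HasDerivAt F (f y) y)
    (hf : ∀ ε > 0, IntegrableOn f {y : ℝ | ε ≤ |x - y|})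
    (hb : Tendsto F atTop (𝓝 b)) (ha : Tendsto F atBot (𝓝 a))
    (hd : Tendsto (fun ε => F (x - ε) - F (x + ε)) (𝓝[>] 0) (𝓝 d)) :
    HasPrincipalValue f x (b - a + d) := by
  refine (hd.const_add (b - a)).congr' ?_
  filter_upwards [self_mem_nhdsWithin] with ε hε
  have hε : 0 < ε := hε
  have hi := hf ε hε
  rw [setOf_le_abs_sub_eq_union ε x] at hi ⊢
  have hi1 := hi.left_of_union
  have hi2 := hi.right_of_union
  have hdisj : Disjoint (Set.Iic (x - ε)) (Set.Ici (x + ε)) := by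
    rw [Set.disjoint_left]
    intro y h1 h2
    simp only [Set.mem_Iic, Set.mem_Ici] at h1 h2
    linarith
  rw [setIntegral_union hdisj measurableSet_Ici hi1 hi2, integral_Ici_eq_integral_Ioi,
    integral_Iic_of_hasDerivAt_of_tendsto' (fun y hy => hF y ?_) hi1 ha,
    integral_Ioi_of_hasDerivAt_of_tendsto' (fun y hy => hF y ?_)
      (hi2.mono_set Set.Ioi_subset_Ici_self) hb]
  · ring
  · rintro rfl
    simp only [Set.mem_Ici] at hy
    linarith
  · rintro rfl
    simp only [Set.mem_Iic] at hy
    linarith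

lemma HasPrincipalValue.const_mul {f : ℝ → ℂ} {x : ℝ} {a : ℂ} (hf : HasPrincipalValue f x a)
    (c : ℂ) : HasPrincipalValue (fun y => c * f y) x (c * a) := by
  refine (Tendsto.const_mul c hf).congr fun ε => ?_
  rw [integral_const_mul]

lemma HasPrincipalValue.add {f g : ℝ → ℂ} {x : ℝ} {a b : ℂ} (hf : HasPrincipalValue f x a)
    (hg : HasPrincipalValue g x b)
    (hfi : ∀ ε > 0, IntegrableOn f {y : ℝ | ε ≤ |x - y|})
    (hgi : ∀ ε > 0, IntegrableOn g {y : ℝ | ε ≤ |x - y|}) :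
    HasPrincipalValue (fun y => f y + g y) x (a + b) := by
  refine (Tendsto.add hf hg).congr' ?_
  filter_upwards [self_mem_nhdsWithin] with ε hε
  rw [integral_add (hfi ε hε) (hgi ε hε)]

lemma HasPrincipalValue.congr {f g : ℝ → ℂ} {x : ℝ} {a : ℂ} (hf : HasPrincipalValue f x a)
    (h : ∀ y ≠ x, f y = g y) : HasPrincipalValue g x a := by
  refine Tendsto.congr' ?_ hf
  filter_upwards [self_mem_nhdsWithin] with ε hε
  refine setIntegral_congr_fun (measurableSet_le (by fun_prop) (by fun_prop)) fun y hy => h y ?_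
  rintro rfl
  simp only [Set.mem_ofPred_eq, sub_self, abs_zero] at hy
  exact absurd hy (not_le.2 hε)

lemma integrable_uFun_div (k : ℤ) : Integrable fun y : ℝ => uFun k y / (1 + (y : ℂ) ^ 2) := by
  refine integrable_inv_one_add_sq.mono' ?_ (ae_of_all _ fun y => ?_)
  · exact ((continuous_uFun k).div (by fun_prop) one_add_ofReal_sq_ne_zero).aestronglyMeasurable
  · rw [norm_div, norm_uFun, ← ofReal_pow, ← ofReal_one, ← ofReal_add, norm_real,
      Real.norm_of_nonneg (by positivity), one_div]

lemma integrableOn_uFun_div_mul (k : ℤ) (x : ℝ) {ε : ℝ} (hε : 0 < ε) :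
    IntegrableOn (fun y : ℝ => uFun k y / (1 + (y : ℂ) ^ 2) / ((x : ℂ) - y))
      {y : ℝ | ε ≤ |x - y|} := by
  have hm : Measurable fun y : ℝ => (x : ℂ) - y := by fun_prop
  refine ((integrable_uFun_div k).norm.integrableOn.mul_const ε⁻¹).mono'
    ((integrable_uFun_div k).aestronglyMeasurable.restrict.aemeasurable.div
      hm.aemeasurable).aestronglyMeasurable ?_
  rw [ae_restrict_iff' (measurableSet_le (by fun_prop) (by fun_prop))]
  refine ae_of_all _ fun y hy => ?_
  rw [norm_div, div_eq_mul_inv, ← ofReal_sub, norm_real, Real.norm_eq_abs]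
  gcongr
  exact hy

lemma hasPrincipalValue_uFun_div {k : ℤ} (hk : Odd k) (x : ℝ) :
    HasPrincipalValue (fun y : ℝ => uFun k y / (1 + (y : ℂ) ^ 2)) x (2 * I / k) := by
  have hk0 : (k : ℂ) ≠ 0 := by
    rw [Int.cast_ne_zero]
    rintro rfl
    simp at hk
  have hF (y : ℝ) : HasDerivAt (fun y => I / k * uFun k y) (uFun k y / (1 + (y : ℂ) ^ 2)) y := by
    refine ((hasDerivAt_uFun k y).const_mul _).congr_deriv ?_
    have := one_add_ofReal_sq_ne_zero y
    field_simp
    rw [I_sq]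
    ring
  have hc : Continuous fun y => I / k * uFun k y := (continuous_uFun k).const_mul _
  have hd : Tendsto (fun ε : ℝ => I / k * uFun k (x - ε) - I / k * uFun k (x + ε))
      (𝓝[>] 0) (𝓝 0) := by
    have : Continuous fun ε : ℝ => I / k * uFun k (x - ε) - I / k * uFun k (x + ε) := by
      have := continuous_uFun k
      fun_prop
    refine tendsto_nhdsWithin_of_tendsto_nhds ((this.tendsto 0).trans ?_)
    simp
  convert hasPrincipalValue_of_hasDerivAt (fun y _ => hF y)
    (fun _ _ => (integrable_uFun_div k).integrableOn) ((tendsto_uFun_atTop k).const_mul _)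
    ((tendsto_uFun_atBot hk).const_mul _) hd using 1
  ring

lemma kernel_add_two (k : ℤ) {x y : ℝ} (hxy : y ≠ x) :
    uFun (k + 2) y / (1 + (y : ℂ) ^ 2) / ((x : ℂ) - y)
      = (x + I) / (x - I) * (uFun k y / (1 + (y : ℂ) ^ 2) / ((x : ℂ) - y))
        + 1 / (x - I) * (uFun (k + 2) y / (1 + (y : ℂ) ^ 2)
          + -1 * (uFun k y / (1 + (y : ℂ) ^ 2))) := by
  have h1 := ofReal_sub_I_ne_zero x
  have h2 := ofReal_sub_I_ne_zero y
  have h3 := one_add_ofReal_sq_ne_zero y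
  have h4 : (x : ℂ) - y ≠ 0 := by
    rw [sub_ne_zero]
    exact_mod_cast hxy.symm
  rw [uFun_add_two]
  field_simp
  ring

lemma hasPrincipalValue_uFun_add_two_sub {k : ℤ} (hk : Odd k) (x : ℝ) :
    HasPrincipalValue (fun y : ℝ => 1 / ((x : ℂ) - I) * (uFun (k + 2) y / (1 + (y : ℂ) ^ 2)
      + -1 * (uFun k y / (1 + (y : ℂ) ^ 2)))) x
      (1 / (x - I) * (2 * I / (k + 2) + -1 * (2 * I / k))) := by
  have h := hasPrincipalValue_uFun_div (hk.add_even even_two) x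
  push_cast at h
  exact (h.add ((hasPrincipalValue_uFun_div hk x).const_mul (-1))
    (fun _ _ => (integrable_uFun_div _).integrableOn)
    (fun _ _ => ((integrable_uFun_div _).const_mul _).integrableOn)).const_mul _

lemma hasPrincipalValue_kernel_add_two {k : ℤ} (hk : Odd k) (x : ℝ) {c : ℂ}
    (h : HasPrincipalValue (fun y : ℝ => uFun k y / (1 + (y : ℂ) ^ 2) / ((x : ℂ) - y)) x c) :
    HasPrincipalValue (fun y : ℝ => uFun (k + 2) y / (1 + (y : ℂ) ^ 2) / ((x : ℂ) - y)) x
      ((x + I) / (x - I) * c + 1 / (x - I) * (2 * I / (k + 2) + -1 * (2 * I / k))) :=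
  ((h.const_mul _).add (hasPrincipalValue_uFun_add_two_sub hk x)
    (fun _ hε => (integrableOn_uFun_div_mul k x hε).const_mul _)
    (fun _ _ => (((integrable_uFun_div _).add
      ((integrable_uFun_div _).const_mul _)).const_mul _).integrableOn)).congr
    fun _ hy => (kernel_add_two k hy).symm

lemma hasPrincipalValue_kernel_of_add_two {k : ℤ} (hk : Odd k) (x : ℝ) {c : ℂ}
    (h : HasPrincipalValue
      (fun y : ℝ => uFun (k + 2) y / (1 + (y : ℂ) ^ 2) / ((x : ℂ) - y)) x c) :
    HasPrincipalValue (fun y : ℝ => uFun k y / (1 + (y : ℂ) ^ 2) / ((x : ℂ) - y)) x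
      ((x - I) / (x + I) * (c + -1 * (1 / (x - I) * (2 * I / (k + 2) + -1 * (2 * I / k))))) := by
  refine (HasPrincipalValue.const_mul (h.add
    ((hasPrincipalValue_uFun_add_two_sub hk x).const_mul (-1))
    (fun _ hε => integrableOn_uFun_div_mul _ x hε)
    (fun _ _ => ((((integrable_uFun_div _).add
      ((integrable_uFun_div _).const_mul _)).const_mul _).const_mul _).integrableOn)) _).congr
    fun y hy => ?_
  rw [kernel_add_two k hy]
  have h1 := ofReal_sub_I_ne_zero x
  have h2 := ofReal_add_I_ne_zero x
  generalize uFun k y / (1 + (y : ℂ) ^ 2) / ((x : ℂ) - y) = K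
  generalize uFun (k + 2) y / (1 + (y : ℂ) ^ 2) = A
  generalize uFun k y / (1 + (y : ℂ) ^ 2) = B
  field_simp
  ring

lemma one_add_mul_add_sqrt_mul_sqrt_pos (x y : ℝ) :
    0 < 1 + x * y + √(1 + x ^ 2) * √(1 + y ^ 2) := by
  have h : |x * y| ≤ √(1 + x ^ 2) * √(1 + y ^ 2) := by
    rw [← Real.sqrt_mul (by positivity)]
    apply Real.abs_le_sqrt
    nlinarith [sq_nonneg x, sq_nonneg y]
  linarith [neg_abs_le (x * y)]

lemma sqrt_one_add_sq_add_pos (x : ℝ) : 0 < √(1 + x ^ 2) + x := by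
  have h : |x| < √(1 + x ^ 2) := by
    rw [← Real.sqrt_sq_eq_abs]
    exact Real.sqrt_lt_sqrt (sq_nonneg x) (by linarith)
  linarith [neg_abs_le x]

/-- A primitive of `1 / ((x - y) √(1 + y²))` away from `y = x`. -/
noncomputable def logPrimitive (x y : ℝ) : ℝ :=
  (Real.log (1 + x * y + √(1 + x ^ 2) * √(1 + y ^ 2)) - Real.log (x - y)) / √(1 + x ^ 2)

lemma hasDerivAt_logPrimitive {x y : ℝ} (hxy : y ≠ x) :
    HasDerivAt (logPrimitive x) (1 / ((x - y) * √(1 + y ^ 2))) y := by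
  have hN := one_add_mul_add_sqrt_mul_sqrt_pos x y
  have hx : x - y ≠ 0 := sub_ne_zero.2 hxy.symm
  have hR : 0 < √(1 + x ^ 2) := by positivity
  have hS : 0 < √(1 + y ^ 2) := by positivity
  have hR2 : √(1 + x ^ 2) ^ 2 = 1 + x ^ 2 := Real.sq_sqrt (by positivity)
  have hS2 : √(1 + y ^ 2) ^ 2 = 1 + y ^ 2 := Real.sq_sqrt (by positivity)
  have h1 : HasDerivAt (fun y => 1 + x * y + √(1 + x ^ 2) * √(1 + y ^ 2))
      (x * 1 + √(1 + x ^ 2) * (y / √(1 + y ^ 2))) y :=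
    (((hasDerivAt_id y).const_mul x).const_add 1).add
      ((hasDerivAt_sqrt_one_add_sq y).const_mul _)
  have h2 := ((h1.log hN.ne').sub (((hasDerivAt_id y).const_sub x).log hx)).div_const √(1 + x ^ 2)
  refine h2.congr_deriv ?_
  simp only [id]
  generalize √(1 + x ^ 2) = R at *
  generalize √(1 + y ^ 2) = S at *
  have hN' := hN.ne'
  field_simp
  linear_combination R * hS2 - S * hR2

lemma tendsto_logPrimitive {l : Filter ℝ} {x c : ℝ} (hl : ∀ᶠ y in l, y ≠ x) (hc : c ≠ 0)
    (hR : x * c + √(1 + x ^ 2) ≠ 0)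
    (h1 : Tendsto (fun y : ℝ => y / √(1 + y ^ 2)) l (𝓝 c))
    (h2 : Tendsto (fun y : ℝ => 1 / √(1 + y ^ 2)) l (𝓝 0)) :
    Tendsto (logPrimitive x) l
      (𝓝 (Real.log ((x * c + √(1 + x ^ 2)) / -c) / √(1 + x ^ 2))) := by
  have hn := ((h1.const_mul x).add h2).add_const √(1 + x ^ 2)
  have hd := (h2.const_mul x).sub h1
  rw [add_zero] at hn
  rw [mul_zero, zero_sub] at hd
  refine Tendsto.div_const ?_ _
  refine ((hn.div hd (neg_ne_zero.2 hc)).log (div_ne_zero hR (neg_ne_zero.2 hc))).congr' ?_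
  filter_upwards [hl] with y hy
  rw [← Real.log_div (one_add_mul_add_sqrt_mul_sqrt_pos x y).ne' (sub_ne_zero.2 hy.symm)]
  congr 1
  have hS : 0 < √(1 + y ^ 2) := by positivity
  simp only [Pi.div_apply]
  rw [← mul_div_mul_right _ _ hS.ne']
  congr 1 <;> field_simp
  ring

lemma hasPrincipalValue_one_div_mul_sqrt (x : ℝ)
    (hi : ∀ ε > 0, IntegrableOn (fun y : ℝ => ((1 / ((x - y) * √(1 + y ^ 2)) : ℝ) : ℂ))
      {y : ℝ | ε ≤ |x - y|}) :
    HasPrincipalValue (fun y : ℝ => ((1 / ((x - y) * √(1 + y ^ 2)) : ℝ) : ℂ)) x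
      ((2 * Real.log (√(1 + x ^ 2) + x) / √(1 + x ^ 2) : ℝ) : ℂ) := by
  have hp := sqrt_one_add_sq_add_pos x
  have hq : 0 < √(1 + x ^ 2) - x := by simpa [← sub_eq_add_neg] using sqrt_one_add_sq_add_pos (-x)
  have hpq : √(1 + x ^ 2) - x = (√(1 + x ^ 2) + x)⁻¹ := by
    refine eq_inv_of_mul_eq_one_left ?_
    linear_combination Real.sq_sqrt (show (0 : ℝ) ≤ 1 + x ^ 2 by positivity)
  have ht := tendsto_logPrimitive (eventually_ne_atTop x) one_ne_zero
    (by linarith : 0 < x * 1 + √(1 + x ^ 2)).ne'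
    tendsto_self_div_sqrt_atTop tendsto_one_div_sqrt_atTop
  have hb := tendsto_logPrimitive (eventually_ne_atBot x) (by norm_num : (-1 : ℝ) ≠ 0)
    (by linarith : 0 < x * -1 + √(1 + x ^ 2)).ne'
    tendsto_self_div_sqrt_atBot tendsto_one_div_sqrt_atBot
  have hd : Tendsto (fun ε => ((logPrimitive x (x - ε) : ℝ) : ℂ) - (logPrimitive x (x + ε) : ℝ))
      (𝓝[>] 0) (𝓝 0) := by
    have hc : Continuous fun y : ℝ =>
        Real.log (1 + x * y + √(1 + x ^ 2) * √(1 + y ^ 2)) / √(1 + x ^ 2) :=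
      (Continuous.log (by fun_prop)
        fun y => (one_add_mul_add_sqrt_mul_sqrt_pos x y).ne').div_const _
    have h1 : Tendsto (fun ε => x - ε) (𝓝[>] 0) (𝓝 x) :=
      tendsto_nhdsWithin_of_tendsto_nhds (by simpa using (continuous_sub_left x).tendsto 0)
    have h2 : Tendsto (fun ε => x + ε) (𝓝[>] 0) (𝓝 x) :=
      tendsto_nhdsWithin_of_tendsto_nhds (by simpa using (continuous_const_add x).tendsto 0)
    have h3 := (((hc.tendsto x).comp h1).sub ((hc.tendsto x).comp h2)).ofReal
    rw [sub_self, ofReal_zero] at h3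
    refine h3.congr fun ε => ?_
    rw [← ofReal_sub]
    congr 1
    simp only [logPrimitive, Function.comp_apply, sub_sub_cancel, sub_add_cancel_left,
      Real.log_neg_eq_log]
    ring
  convert hasPrincipalValue_of_hasDerivAt
    (fun y hy => (hasDerivAt_logPrimitive hy).ofReal_comp) hi ht.ofReal hb.ofReal hd using 1
  have e1 : (x * 1 + √(1 + x ^ 2)) / -1 = -(√(1 + x ^ 2) + x) := by ring
  have e2 : (x * -1 + √(1 + x ^ 2)) / - -1 = (√(1 + x ^ 2) + x)⁻¹ := by rw [← hpq]; ring
  rw [e1, e2, Real.log_neg_eq_log, Real.log_inv]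
  push_cast
  ring

lemma hasPrincipalValue_kernel_one (x : ℝ) :
    HasPrincipalValue (fun y : ℝ => uFun 1 y / (1 + (y : ℂ) ^ 2) / ((x : ℂ) - y)) x
      (1 / (x - I) * (((2 * Real.log (√(1 + x ^ 2) + x) / √(1 + x ^ 2) : ℝ) : ℂ) + 2 * I)) := by
  have hx := ofReal_sub_I_ne_zero x
  have key {y : ℝ} (hy : y ≠ x) : ((1 / ((x - y) * √(1 + y ^ 2)) : ℝ) : ℂ)
      = (x - I) * (uFun 1 y / (1 + (y : ℂ) ^ 2) / ((x : ℂ) - y))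
        + -1 * (uFun 1 y / (1 + (y : ℂ) ^ 2)) := by
    have h1 := ofReal_sqrt_one_add_sq_ne_zero y
    have h2 := one_add_ofReal_sq_ne_zero y
    have h3 : (x : ℂ) - y ≠ 0 := by
      rw [sub_ne_zero]
      exact_mod_cast hy.symm
    rw [uFun_one]
    push_cast
    field_simp
    linear_combination I_sq
  have hi : ∀ ε > 0, IntegrableOn (fun y : ℝ => ((1 / ((x - y) * √(1 + y ^ 2)) : ℝ) : ℂ))
      {y : ℝ | ε ≤ |x - y|} := fun ε hε => by
    refine IntegrableOn.congr_fun (((integrableOn_uFun_div_mul 1 x hε).const_mul (x - I)).add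
      ((integrable_uFun_div 1).const_mul (-1)).integrableOn) (fun y hy => (key ?_).symm)
      (measurableSet_le (by fun_prop) (by fun_prop))
    rintro rfl
    simp only [Set.mem_ofPred_eq, sub_self, abs_zero] at hy
    exact absurd hy (not_le.2 hε)
  have h1 := hasPrincipalValue_uFun_div odd_one x
  rw [Int.cast_one, div_one] at h1
  refine (HasPrincipalValue.const_mul ((hasPrincipalValue_one_div_mul_sqrt x hi).add h1 hi
    fun _ _ => (integrable_uFun_div 1).integrableOn) _).congr fun y hy => ?_
  rw [key hy, neg_one_mul, neg_add_cancel_right, one_div, inv_mul_cancel_left₀ hx]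

/-- The series `∑ wⁿ / ((a - 1 + n) (a + n) (a + 1 + n))`. -/
noncomputable def reciprocalSeries (a w : ℂ) : ℂ :=
  ∑' n : ℕ, w ^ n / ((a - 1 + n) * (a + n) * (a + 1 + n))

lemma Odd.intCast_div_two_add_natCast_ne_zero {k : ℤ} (hk : Odd k) (n : ℕ) :
    (k : ℂ) / 2 + n ≠ 0 := by
  intro h
  have h2 : ((k + 2 * n : ℤ) : ℂ) = 0 := by
    push_cast
    linear_combination 2 * h
  rw [Int.cast_eq_zero] at h2
  obtain ⟨m, rfl⟩ := hk
  omega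

lemma Odd.half_le_abs_div_two_add {k : ℤ} (hk : Odd k) (n : ℕ) :
    1 / 2 ≤ |(n : ℝ) + (k : ℝ) / 2| := by
  have h : (1 : ℤ) ≤ |k + 2 * n| := Int.one_le_abs fun h => by
    obtain ⟨m, rfl⟩ := hk
    omega
  have h2 : (1 : ℝ) ≤ |(k : ℝ) + 2 * n| := by exact_mod_cast h
  rw [show (n : ℝ) + k / 2 = (k + 2 * n) / 2 by ring, abs_div, abs_two]
  linarith

lemma summable_norm_reciprocal {k : ℤ} (hk : Odd k) :
    Summable fun n : ℕ =>
      ‖1 / (((k : ℂ) / 2 - 1 + n) * ((k : ℂ) / 2 + n) * ((k : ℂ) / 2 + 1 + n))‖ := by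
  have hs (a : ℝ) : Summable fun n : ℕ => 1 / |(n : ℝ) + a| ^ 2 := by
    simpa using (Real.summable_one_div_nat_add_rpow a 2).2 one_lt_two
  refine Summable.of_nonneg_of_le (fun _ => norm_nonneg _) (fun n => ?_)
    ((hs (((k - 2 : ℤ) : ℝ) / 2)).add (hs ((k : ℝ) / 2)))
  have h1 := (hk.sub_even even_two).half_le_abs_div_two_add n
  have h2 := hk.half_le_abs_div_two_add n
  have h3 := (hk.add_even even_two).half_le_abs_div_two_add n
  have e1 : (k : ℂ) / 2 - 1 + n = (((n : ℝ) + ((k - 2 : ℤ) : ℝ) / 2 : ℝ) : ℂ) := by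
    push_cast; ring
  have e2 : (k : ℂ) / 2 + n = (((n : ℝ) + (k : ℝ) / 2 : ℝ) : ℂ) := by
    push_cast; ring
  have e3 : (k : ℂ) / 2 + 1 + n = (((n : ℝ) + ((k + 2 : ℤ) : ℝ) / 2 : ℝ) : ℂ) := by
    push_cast; ring
  rw [e1, e2, e3, norm_div, norm_mul, norm_mul, norm_one, norm_real, norm_real, norm_real,
    Real.norm_eq_abs, Real.norm_eq_abs, Real.norm_eq_abs]
  generalize |(n : ℝ) + ((k - 2 : ℤ) : ℝ) / 2| = p at *
  generalize |(n : ℝ) + (k : ℝ) / 2| = q at *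
  generalize |(n : ℝ) + ((k + 2 : ℤ) : ℝ) / 2| = r at *
  have hp : 0 < p := by linarith
  have hq : 0 < q := by linarith
  have hr : 1 / r ≤ 2 := by
    rw [div_le_iff₀ (by linarith)]
    linarith
  calc 1 / (p * q * r) = (1 / p) * (1 / q) * (1 / r) := by field_simp
    _ ≤ (1 / p) * (1 / q) * 2 := by gcongr
    _ ≤ (1 / p) ^ 2 + (1 / q) ^ 2 := by nlinarith [sq_nonneg (1 / p - 1 / q)]
    _ = 1 / p ^ 2 + 1 / q ^ 2 := by simp

lemma norm_reciprocalSeries_term_le (a : ℂ) {w : ℂ} (hw : ‖w‖ ≤ 1) (n : ℕ) :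
    ‖w ^ n / ((a - 1 + n) * (a + n) * (a + 1 + n))‖
      ≤ ‖1 / ((a - 1 + n) * (a + n) * (a + 1 + n))‖ := by
  rw [norm_div, norm_div, norm_pow, norm_one]
  gcongr
  exact pow_le_one₀ (norm_nonneg _) hw

lemma summable_reciprocalSeries {k : ℤ} (hk : Odd k) {w : ℂ} (hw : ‖w‖ ≤ 1) :
    Summable fun n : ℕ =>
      w ^ n / (((k : ℂ) / 2 - 1 + n) * ((k : ℂ) / 2 + n) * ((k : ℂ) / 2 + 1 + n)) :=
  Summable.of_norm_bounded (summable_norm_reciprocal hk)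
    fun n => norm_reciprocalSeries_term_le _ hw n

lemma reciprocalSeries_eq_add {k : ℤ} (hk : Odd k) {w : ℂ} (hw : ‖w‖ ≤ 1) :
    reciprocalSeries (k / 2) w = 1 / (((k : ℂ) / 2 - 1) * (k / 2) * (k / 2 + 1))
      + w * reciprocalSeries ((k + 2 : ℤ) / 2) w := by
  rw [reciprocalSeries, (summable_reciprocalSeries hk hw).tsum_eq_zero_add, reciprocalSeries,
    ← tsum_mul_left]
  congr 1
  · simp
  · refine tsum_congr fun n => ?_
    rw [pow_succ', mul_div_assoc]
    push_cast
    ring_nf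

lemma tendsto_reciprocalSeries {k : ℤ} (hk : Odd k) {l : Filter ℝ} {f : ℝ → ℂ} {w : ℂ}
    (hf : Tendsto f l (𝓝 w)) (hle : ∀ᶠ r in l, ‖f r‖ ≤ 1) :
    Tendsto (fun r => reciprocalSeries (k / 2) (f r)) l (𝓝 (reciprocalSeries (k / 2) w)) :=
  tendsto_tsum_of_dominated_convergence (summable_norm_reciprocal hk)
    (fun n => (hf.pow n).div_const _)
    (hle.mono fun _ hr n => norm_reciprocalSeries_term_le _ hr n)

lemma HasSum.congr_of_eq {f g : ℕ → ℂ} {a b : ℂ} (h : HasSum f a) (hfg : ∀ n, g n = f n)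
    (hab : b = a) : HasSum g b := by
  rwa [funext hfg, hab]

lemma hasSum_artanh {z : ℂ} (hz : ‖z‖ < 1) :
    HasSum (fun n : ℕ => z ^ (2 * n + 1) / (2 * n + 1)) (log ((1 + z) / (1 - z)) / 2) := by
  have h := (hasSum_arctan (z := -I * z) (by simpa using hz)).mul_left I
  have e : -I * z * I = z := by linear_combination -z * I_sq
  rw [arctan, e] at h
  refine h.congr_of_eq (fun n => ?_) ?_
  · have e2 : (-I * z) ^ (2 * n + 1) = -I * (-1) ^ n * z ^ (2 * n + 1) := by
      rw [mul_pow, pow_succ (-I), pow_mul, neg_sq, I_sq]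
      ring
    have e3 : ((-1 : ℂ) ^ n) * (-1) ^ n = 1 := by
      rw [← mul_pow]
      simp
    rw [e2]
    push_cast
    linear_combination (z ^ (2 * n + 1) / (2 * n + 1)) * (I ^ 2 * e3 + I_sq)
  · linear_combination log ((1 + z) / (1 - z)) / 2 * I_sq

lemma reciprocalSeries_half {z : ℂ} (hz : ‖z‖ < 1) (hz0 : z ≠ 0) :
    reciprocalSeries ((1 : ℤ) / 2) (z ^ 2)
      = -1 - 1 / z ^ 2 + log ((1 + z) / (1 - z)) / 2 / z * (z - 1 / z) ^ 2 := by
  have h := (hasSum_artanh hz).mul_left (2 / z)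
  have hne (n : ℕ) : (2 * (n : ℂ) + 1) ≠ 0 := by exact_mod_cast (2 * n).succ_ne_zero
  have hne3 (n : ℕ) : (2 * (n : ℂ) + 3) ≠ 0 := by exact_mod_cast (2 * n + 2).succ_ne_zero
  have hne1 (n : ℕ) : (2 * (n : ℂ) - 1) ≠ 0 := fun h => by
    have h2 : ((2 * n - 1 : ℤ) : ℂ) = 0 := by exact_mod_cast h
    rw [Int.cast_eq_zero] at h2
    omega
  have h3 := ((hasSum_nat_add_iff' 1).2 h).mul_left (1 / z ^ 2)
  have h1 : HasSum (fun n : ℕ => 2 * (z ^ 2) ^ n / (2 * n - 1))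
      (z ^ 2 * (2 / z * (log ((1 + z) / (1 - z)) / 2)) - 2) := by
    rw [← hasSum_nat_add_iff' 1]
    refine (h.mul_left (z ^ 2)).congr_of_eq (fun n => ?_) ?_
    · have h1 := hne n
      have h2 : 2 * ((n : ℂ) + 1) - 1 ≠ 0 := by convert h1 using 1; ring
      push_cast
      field_simp
      ring
    · simp
      ring
  have hsum := (((h1.mul_left (1 / 2)).sub h).add (h3.mul_left (1 / 2)))
  rw [reciprocalSeries]
  refine (HasSum.tsum_eq ?_)
  refine hsum.congr_of_eq (fun n => ?_) ?_
  · have h0 := hne n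
    have h1 := hne1 n
    have h3 := hne3 n
    have e1 : ((1 : ℤ) : ℂ) / 2 - 1 + n = (2 * n - 1) / 2 := by push_cast; ring
    have e2 : ((1 : ℤ) : ℂ) / 2 + n = (2 * n + 1) / 2 := by push_cast; ring
    have e3 : ((1 : ℤ) : ℂ) / 2 + 1 + n = (2 * n + 3) / 2 := by push_cast; ring
    have e4 : 2 * (((n + 1 : ℕ) : ℂ)) + 1 = 2 * n + 3 := by push_cast; ring
    rw [e1, e2, e3, e4]
    field_simp
    ring
  · simp
    field_simp
    ring

lemma reciprocalSeries_half_of_norm_eq_one {z : ℂ} (hz : ‖z‖ = 1)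
    (hslit : (1 + z) / (1 - z) ∈ slitPlane) :
    reciprocalSeries ((1 : ℤ) / 2) (z ^ 2)
      = -1 - 1 / z ^ 2 + log ((1 + z) / (1 - z)) / 2 / z * (z - 1 / z) ^ 2 := by
  have hz0 : z ≠ 0 := by
    rw [← norm_ne_zero_iff, hz]
    exact one_ne_zero
  have hz1 : 1 - z ≠ 0 := fun h => by simp [h] at hslit
  have hf : Tendsto (fun r : ℝ => (r : ℂ) * z) (𝓝[<] 1) (𝓝 z) := by
    have : Continuous fun r : ℝ => (r : ℂ) * z := by fun_prop
    refine tendsto_nhdsWithin_of_tendsto_nhds ((this.tendsto 1).trans ?_)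
    simp
  have hev : ∀ᶠ r : ℝ in 𝓝[<] 1, ‖(r : ℂ) * z‖ < 1 ∧ (r : ℂ) * z ≠ 0 := by
    filter_upwards [Ioo_mem_nhdsLT zero_lt_one] with r hr
    rw [norm_mul, hz, norm_real, Real.norm_of_nonneg hr.1.le, mul_one]
    exact ⟨hr.2, mul_ne_zero (ofReal_ne_zero.2 hr.1.ne') hz0⟩
  have hl := tendsto_reciprocalSeries odd_one (hf.pow 2) (hev.mono fun r hr => by
    rw [norm_pow]
    exact pow_le_one₀ (norm_nonneg _) hr.1.le)
  have hc : ContinuousAt (fun z : ℂ =>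
      -1 - 1 / z ^ 2 + log ((1 + z) / (1 - z)) / 2 / z * (z - 1 / z) ^ 2) z := by
    have h2 : z ^ 2 ≠ 0 := pow_ne_zero 2 hz0
    have h3 : ContinuousAt (fun z : ℂ => (1 + z) / (1 - z)) z :=
      (by fun_prop : ContinuousAt (fun z : ℂ => 1 + z) z).div (by fun_prop) hz1
    have h4 := h3.clog hslit
    fun_prop (disch := assumption)
  refine tendsto_nhds_unique hl ((hc.tendsto.comp hf).congr' ?_)
  filter_upwards [hev] with r hr
  exact (reciprocalSeries_half hr.1 hr.2).symm

lemma norm_sub_I_div_add_I (x : ℝ) : ‖((x : ℂ) - I) / (x + I)‖ = 1 := by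
  rw [← inv_div, ← uFun_two, norm_inv, norm_pow, norm_uFun]
  simp

lemma reciprocalSeries_half_sub_I_div_add_I (x : ℝ) :
    reciprocalSeries ((1 : ℤ) / 2) ((x - I) / (x + I))
      = -1 - (x + I) / (x - I)
        - 2 * (Real.log (√(1 + x ^ 2) + x) - Real.pi / 2 * I) * (x + I)
          / (√(1 + x ^ 2) : ℂ) ^ 3 := by
  have hS := ofReal_sqrt_one_add_sq_ne_zero x
  have hS2 := ofReal_sqrt_one_add_sq_sq x
  have hq := sqrt_one_add_sq_add_pos x
  have hm := ofReal_sub_I_ne_zero x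
  have hp := ofReal_add_I_ne_zero x
  have hzz : (uFun 1 x)⁻¹ ^ 2 = ((x : ℂ) - I) / (x + I) := by
    rw [inv_pow, uFun_two, inv_div]
  have hz : (uFun 1 x)⁻¹ = (x - I) / (√(1 + x ^ 2) : ℂ) := by
    rw [uFun_one, inv_div, div_eq_div_iff hp hS, ← sq, hS2, mul_comm, add_I_mul_sub_I]
  have hd : (√(1 + x ^ 2) : ℂ) - (x - I) ≠ 0 := fun h => by
    simpa using congrArg Complex.im h
  have hquot : (1 + (uFun 1 x)⁻¹) / (1 - (uFun 1 x)⁻¹)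
      = ((√(1 + x ^ 2) + x : ℝ) : ℂ) * -I := by
    rw [hz, one_add_div hS, one_sub_div hS, div_div_div_cancel_right₀ hS, div_eq_iff hd]
    push_cast
    linear_combination I * hS2 + (√(1 + x ^ 2) + x : ℂ) * I_sq
  have hslit : (1 + (uFun 1 x)⁻¹) / (1 - (uFun 1 x)⁻¹) ∈ slitPlane := by
    rw [hquot, mem_slitPlane_iff]
    right
    rw [mul_neg, neg_im, im_ofReal_mul, I_im, mul_one]
    exact (neg_neg_of_pos hq).ne
  have hlog : log ((1 + (uFun 1 x)⁻¹) / (1 - (uFun 1 x)⁻¹))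
      = Real.log (√(1 + x ^ 2) + x) - Real.pi / 2 * I := by
    rw [hquot, log_ofReal_mul hq (neg_ne_zero.2 I_ne_zero), log_neg_I]
    ring
  rw [← hzz, reciprocalSeries_half_of_norm_eq_one (by rw [norm_inv, norm_uFun, inv_one]) hslit,
    hlog, one_div, ← inv_pow, inv_inv, uFun_two, one_div, inv_inv, hz, uFun_one]
  have h4 : ((x : ℂ) - I) / (√(1 + x ^ 2) : ℂ) - (x + I) / (√(1 + x ^ 2) : ℂ)
      = -2 * I / (√(1 + x ^ 2) : ℂ) := by ring
  have h5 : (√(1 + x ^ 2) : ℂ) / (x - I) = (x + I) / (√(1 + x ^ 2) : ℂ) := by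
    rw [div_eq_div_iff hm hS, ← sq, hS2, add_I_mul_sub_I]
  rw [h4, div_eq_mul_inv _ (((x : ℂ) - I) / _), inv_div, h5]
  linear_combination
    2 * (Real.log (√(1 + x ^ 2) + x) - Real.pi / 2 * I) * (x + I) / (√(1 + x ^ 2) : ℂ) ^ 3 * I_sq

/-- The value of `PV∫ u_k(y) / ((1 + y²) (x - y)) dy` for odd `k`. -/
noncomputable def kernelValue (k : ℤ) (x : ℝ) : ℂ :=
  2 / (k * (k - 2)) + I * Real.pi * uFun k x / (1 + (x : ℂ) ^ 2)
    - reciprocalSeries (k / 2) ((x - I) / (x + I))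

lemma kernelValue_one (x : ℝ) : kernelValue 1 x =
    1 / (x - I) * (((2 * Real.log (√(1 + x ^ 2) + x) / √(1 + x ^ 2) : ℝ) : ℂ) + 2 * I) := by
  have hS := ofReal_sqrt_one_add_sq_ne_zero x
  have hS2 := ofReal_sqrt_one_add_sq_sq x
  have hm := ofReal_sub_I_ne_zero x
  have h5 : 1 / ((x : ℂ) - I) = (x + I) / (√(1 + x ^ 2) : ℂ) ^ 2 := by
    rw [div_eq_div_iff hm (pow_ne_zero 2 hS), one_mul, hS2, add_I_mul_sub_I]
  have h6 : ((x : ℂ) + I) / (x - I) = 1 + 2 * I * (1 / (x - I)) := by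
    field_simp
    ring
  rw [kernelValue, reciprocalSeries_half_sub_I_div_add_I, uFun_one, ← hS2, h6, h5]
  push_cast
  ring

lemma Odd.intCast_ne_zero_and_two {k : ℤ} (hk : Odd k) :
    (k : ℂ) ≠ 0 ∧ (k : ℂ) - 2 ≠ 0 ∧ (k : ℂ) + 2 ≠ 0 := by
  obtain ⟨m, rfl⟩ := hk
  refine ⟨?_, ?_, ?_⟩ <;> norm_cast <;> omega

lemma kernelValue_add_two {k : ℤ} (hk : Odd k) (x : ℝ) :
    kernelValue (k + 2) x = (x + I) / (x - I) * kernelValue k x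
      + 1 / (x - I) * (2 * I / (k + 2) + -1 * (2 * I / k)) := by
  obtain ⟨h0, h1, h2⟩ := hk.intCast_ne_zero_and_two
  have hm := ofReal_sub_I_ne_zero x
  have hp := ofReal_add_I_ne_zero x
  have hx := one_add_ofReal_sq_ne_zero x
  have e1 : (k : ℂ) / 2 - 1 = (k - 2) / 2 := by ring
  have e2 : (k : ℂ) / 2 + 1 = (k + 2) / 2 := by ring
  rw [kernelValue, kernelValue, reciprocalSeries_eq_add hk (norm_sub_I_div_add_I x).le,
    uFun_add_two, e1, e2]
  push_cast
  rw [add_sub_cancel_right]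
  field_simp
  ring

lemma hasPrincipalValue_kernel {k : ℤ} (hk : Odd k) (x : ℝ) :
    HasPrincipalValue (fun y : ℝ => uFun k y / (1 + (y : ℂ) ^ 2) / ((x : ℂ) - y)) x
      (kernelValue k x) := by
  obtain ⟨m, rfl⟩ := hk
  induction m using Int.induction_on with
  | zero =>
    simp only [mul_zero, zero_add]
    rw [kernelValue_one]
    exact hasPrincipalValue_kernel_one x
  | succ n ih =>
    have hodd : Odd (2 * (n : ℤ) + 1) := ⟨n, rfl⟩
    have h := hasPrincipalValue_kernel_add_two hodd x ih
    rw [← kernelValue_add_two hodd] at h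
    rwa [show 2 * ((n : ℤ) + 1) + 1 = 2 * n + 1 + 2 by ring]
  | pred n ih =>
    have hodd : Odd (2 * (-(n : ℤ) - 1) + 1) := ⟨_, rfl⟩
    have e : 2 * -(n : ℤ) + 1 = 2 * (-(n : ℤ) - 1) + 1 + 2 := by ring
    rw [e] at ih
    have h := hasPrincipalValue_kernel_of_add_two hodd x ih
    convert h using 1
    rw [kernelValue_add_two hodd]
    have hm := ofReal_sub_I_ne_zero x
    have hp := ofReal_add_I_ne_zero x
    generalize 1 / ((x : ℂ) - I) * (2 * I / (((2 * (-(n : ℤ) - 1) + 1 : ℤ) : ℂ) + 2)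
      + -1 * (2 * I / ((2 * (-(n : ℤ) - 1) + 1 : ℤ) : ℂ))) = D
    rw [neg_one_mul, add_neg_cancel_right]
    field_simp

lemma ascPochhammer_eval_mul_eq (b : ℂ) (n : ℕ) :
    (ascPochhammer ℂ n).eval b * ((b + n) * (b + n + 1) * (b + n + 2))
      = b * (b + 1) * (b + 2) * (ascPochhammer ℂ n).eval (b + 3) := by
  induction n with
  | zero => simp
  | succ n ih =>
    rw [ascPochhammer_succ_eval, ascPochhammer_succ_eval]
    push_cast
    linear_combination (b + n + 3) * ih

lemma tsum_ascPochhammer_eq {k : ℤ} (hk : Odd k) (w : ℂ) :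
    ∑' n : ℕ, (ascPochhammer ℂ n).eval 1 * (ascPochhammer ℂ n).eval ((k : ℂ) / 2 - 1)
        / ((ascPochhammer ℂ n).eval ((k : ℂ) / 2 + 2) * (n.factorial : ℂ)) * w ^ n
      = ((k : ℂ) / 2 - 1) * (k / 2) * (k / 2 + 1) * reciprocalSeries (k / 2) w := by
  rw [reciprocalSeries, ← tsum_mul_left]
  refine tsum_congr fun n => ?_
  have hn : (n.factorial : ℂ) ≠ 0 := by exact_mod_cast n.factorial_ne_zero
  have hp (m : ℕ) : (ascPochhammer ℂ m).eval ((k : ℂ) / 2 + 2) ≠ 0 := by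
    induction m with
    | zero => simp
    | succ m ih =>
      rw [ascPochhammer_succ_eval]
      refine mul_ne_zero ih ?_
      convert hk.intCast_div_two_add_natCast_ne_zero (m + 2) using 1
      push_cast
      ring
  have h1 : (k : ℂ) / 2 - 1 + n ≠ 0 := by
    convert (hk.sub_even even_two).intCast_div_two_add_natCast_ne_zero n using 1
    push_cast
    ring
  have h2 := hk.intCast_div_two_add_natCast_ne_zero n
  have h3 : (k : ℂ) / 2 + 1 + n ≠ 0 := by
    convert hk.intCast_div_two_add_natCast_ne_zero (n + 1) using 1
    push_cast
    ring
  have key := ascPochhammer_eval_mul_eq ((k : ℂ) / 2 - 1) n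
  rw [show (k : ℂ) / 2 - 1 + 3 = k / 2 + 2 by ring] at key
  have hpn := hp n
  rw [ascPochhammer_eval_one, mul_comm (n.factorial : ℂ), mul_div_mul_right _ _ hn, ← mul_div_assoc,
    div_mul_eq_mul_div, div_eq_div_iff hpn (mul_ne_zero (mul_ne_zero h1 h2) h3)]
  linear_combination w ^ n * key

/-- For `k` odd, `x ∈ ℝ` and `w = (x−i)²/(x²+1)`, the principal value
`(1/π)·PV∫ u_k'(y)/(x−y) dy` exists and equals
`−2i/(π(k−2)) + k(x+i)^k/(x²+1)^{k/2+1} − (8i/(π(4−k²)))·₂F₁(1, k/2−1; k/2+2; w)`. -/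
theorem halfLaplacian_uFun_odd_2F1_conj (k : ℤ) (hk : Odd k) (x : ℝ) (w : ℂ)
    (hw : w = ((x : ℂ) - Complex.I) ^ 2 / ((x : ℂ) ^ 2 + 1)) :
    Tendsto (fun ε : ℝ => (1 / (Real.pi : ℂ)) *
        ∫ y in {y : ℝ | ε ≤ |x - y|}, deriv (uFun k) y / ((x : ℂ) - (y : ℂ)))
      (nhdsWithin 0 (Set.Ioi 0))
      (nhds (
        -2 * Complex.I / ((Real.pi : ℂ) * ((k : ℂ) - 2))
        + (k : ℂ) * ((x : ℂ) + Complex.I) ^ k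
            / ((((x ^ 2 + 1 : ℝ) ^ ((k : ℝ) / 2 + 1) : ℝ)) : ℂ)
        - (8 * Complex.I / ((Real.pi : ℂ) * (4 - (k : ℂ) ^ 2))) *
            ∑' n : ℕ, (ascPochhammer ℂ n).eval 1
              * (ascPochhammer ℂ n).eval ((k : ℂ) / 2 - 1)
              / ((ascPochhammer ℂ n).eval ((k : ℂ) / 2 + 2) * (n.factorial : ℂ))
              * w ^ n)) := by
  obtain ⟨h0, h1, h2⟩ := hk.intCast_ne_zero_and_two
  have hπ : (Real.pi : ℂ) ≠ 0 := ofReal_ne_zero.2 Real.pi_ne_zero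
  have hx := one_add_ofReal_sq_ne_zero x
  have h4 : (4 : ℂ) - (k : ℂ) ^ 2 ≠ 0 := by
    rw [show (4 : ℂ) - (k : ℂ) ^ 2 = -((k - 2) * (k + 2)) by ring]
    exact neg_ne_zero.2 (mul_ne_zero h1 h2)
  have hw' : w = (x - I) / (x + I) := by
    have hm := ofReal_sub_I_ne_zero x
    have hp := ofReal_add_I_ne_zero x
    rw [hw, add_comm ((x : ℂ) ^ 2), ← add_I_mul_sub_I]
    field_simp
  have hu : (k : ℂ) * ((x : ℂ) + I) ^ k / ((((x ^ 2 + 1 : ℝ) ^ ((k : ℝ) / 2 + 1) : ℝ)) : ℂ)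
      = k * uFun k x / (1 + (x : ℂ) ^ 2) := by
    rw [Real.rpow_add (by positivity), Real.rpow_one, uFun, mul_div_assoc, mul_div_assoc,
      div_div, ofReal_mul]
    push_cast
    ring
  have h := ((hasPrincipalValue_kernel hk x).const_mul (-I * k)).const_mul (1 / (Real.pi : ℂ))
  rw [tsum_ascPochhammer_eq hk, hw', hu]
  unfold HasPrincipalValue at h
  convert h using 1
  · funext ε
    rw [← integral_const_mul]
    congr 1
    funext y
    rw [(hasDerivAt_uFun k y).deriv]
    ring
  · congr 1
    rw [kernelValue]
    field_simp
    linear_combination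
      -(Real.pi * k * uFun k x * (64 - 32 * k - 16 * (k : ℂ) ^ 2 + 8 * (k : ℂ) ^ 3)) * I_sq
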